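/- arXiv:1809.08367 — 2 statements merged into one kernel-verified Lean document; each statement's English description precedes it below -/
import Mathlib

section
/- Let M₁,…,Mₘ be n×n matrices with complex entries, let P := M₁·M₂⋯Mₘ, and let 𝓜 be the mn×mn cyclic block matrix associated to M₁,…,Mₘ. Then for every z ∈ ℂ, det(𝓜^m − z·I_{mn}) = (det(P − z·I_n))^m; in other words, the eigenvalues of 𝓜^m are exactly the eigenvalues of P, each with multiplicity m. -/
open Matrix

noncomputable section

/-- the `mn×mn` cyclic block matrix associated to `A₁,…,Aₘ`: its `(i, i+1 mod m)` block
is `Aᵢ` and all other `n×n` blocks are zero. -/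
def cyclicBlock {R : Type*} [Zero R] {m n : ℕ} (A : Fin m → Matrix (Fin n) (Fin n) R) :
    Matrix (Fin m × Fin n) (Fin m × Fin n) R :=
  Matrix.of fun p q => if (q.1 : ℕ) = ((p.1 : ℕ) + 1) % m then A p.1 p.2 q.2 else 0

section CyclicBlock

variable {R : Type*} [CommRing R] {m n : ℕ}

/-- The product of `l` cyclically consecutive members of the family `A`, starting at index `k`. -/
def cyclicProd (hm : 0 < m) (A : Fin m → Matrix (Fin n) (Fin n) R) (k l : ℕ) :
    Matrix (Fin n) (Fin n) R :=
  (List.ofFn fun i : Fin l => A ⟨(k + i) % m, Nat.mod_lt _ hm⟩).prod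

theorem cyclicProd_succ (hm : 0 < m) (A : Fin m → Matrix (Fin n) (Fin n) R) (k l : ℕ) :
    cyclicProd hm A k (l + 1) = cyclicProd hm A k l * A ⟨(k + l) % m, Nat.mod_lt _ hm⟩ := by
  simp only [cyclicProd, List.ofFn_succ', List.concat_eq_append, List.prod_append]
  simp

theorem cyclicProd_succ' (hm : 0 < m) (A : Fin m → Matrix (Fin n) (Fin n) R) (k l : ℕ) :
    cyclicProd hm A k (l + 1) = A ⟨k % m, Nat.mod_lt _ hm⟩ * cyclicProd hm A (k + 1) l := by
  simp [cyclicProd, List.ofFn_succ, add_assoc, add_comm 1]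

theorem cyclicProd_zero_self (hm : 0 < m) (A : Fin m → Matrix (Fin n) (Fin n) R) :
    cyclicProd hm A 0 m = (List.ofFn A).prod := by
  simp [cyclicProd, Nat.mod_eq_of_lt]

theorem charpoly_cyclicProd_self (hm : 0 < m) (A : Fin m → Matrix (Fin n) (Fin n) R) (k : ℕ) :
    (cyclicProd hm A k m).charpoly = (List.ofFn A).prod.charpoly := by
  induction k with
  | zero => rw [cyclicProd_zero_self]
  | succ k ih =>
    rw [← ih]
    obtain ⟨l, rfl⟩ := Nat.exists_eq_add_of_lt hm
    simp only [Nat.zero_add] at *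
    rw [cyclicProd_succ, cyclicProd_succ', charpoly_mul_comm]
    simp [add_assoc, add_comm 1]

theorem cyclicBlock_pow_apply (hm : 0 < m) (A : Fin m → Matrix (Fin n) (Fin n) R) (l : ℕ)
    (p q : Fin m × Fin n) :
    (cyclicBlock A ^ l) p q =
      if (q.1 : ℕ) = (p.1 + l) % m then cyclicProd hm A p.1 l p.2 q.2 else 0 := by
  induction l generalizing q with
  | zero =>
    obtain ⟨i, a⟩ := p
    obtain ⟨j, b⟩ := q
    simp [cyclicProd, Matrix.one_apply, Nat.mod_eq_of_lt, Fin.ext_iff, eq_comm, ← ite_and]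
  | succ l ih =>
    have key (r : Fin m) : ((r : ℕ) = (p.1 + l) % m) ↔ r = ⟨(p.1 + l) % m, Nat.mod_lt _ hm⟩ := by
      simp [Fin.ext_iff]
    simp only [pow_succ, Matrix.mul_apply, ih, Fintype.sum_prod_type, key, ite_mul, zero_mul]
    rw [Finset.sum_eq_single ⟨(p.1 + l) % m, Nat.mod_lt _ hm⟩ (by simp +contextual) (by simp)]
    simp only [cyclicBlock, of_apply, if_true, Nat.mod_add_mod, mul_ite, mul_zero,
      cyclicProd_succ, Matrix.mul_apply, add_assoc]
    split_ifs <;> simp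

theorem cyclicBlock_pow_self (hm : 0 < m) (A : Fin m → Matrix (Fin n) (Fin n) R) :
    cyclicBlock A ^ m = Matrix.reindex (Equiv.prodComm _ _) (Equiv.prodComm _ _)
      (blockDiagonal fun k : Fin m => cyclicProd hm A k m) := by
  ext p q
  simp [cyclicBlock_pow_apply hm, blockDiagonal_apply, Nat.mod_eq_of_lt, Fin.ext_iff, eq_comm]

end CyclicBlock

theorem Matrix.charpoly_blockDiagonal {R ι κ : Type*} [CommRing R] [Fintype ι] [DecidableEq ι]
    [Fintype κ] [DecidableEq κ] (A : κ → Matrix ι ι R) :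
    (blockDiagonal A).charpoly = ∏ k, (A k).charpoly := by
  simp only [charpoly, ← det_blockDiagonal]
  congr 1
  ext ⟨i, k⟩ ⟨j, l⟩ : 1
  by_cases h : k = l <;> by_cases h' : i = j <;>
    simp [blockDiagonal_apply, h, h']

theorem Matrix.det_sub_smul_one {R ι : Type*} [CommRing R] [Fintype ι] [DecidableEq ι]
    (A : Matrix ι ι R) (z : R) :
    (A - z • 1).det = (-1) ^ Fintype.card ι * A.charpoly.eval z := by
  rw [eval_charpoly, ← det_neg, neg_sub, scalar_apply, smul_one_eq_diagonal]

theorem charpoly_cyclicBlock_pow_self {R : Type*} [CommRing R] {m n : ℕ} (hm : 0 < m)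
    (A : Fin m → Matrix (Fin n) (Fin n) R) :
    (cyclicBlock A ^ m).charpoly = (List.ofFn A).prod.charpoly ^ m := by
  simp [cyclicBlock_pow_self hm, charpoly_reindex, charpoly_blockDiagonal,
    charpoly_cyclicProd_self, -reindex_apply]

/-- for `n×n` complex matrices `M₁,…,Mₘ` with product `P = M₁⋯Mₘ` and
associated cyclic block matrix `𝓜`, one has `det(𝓜^m − zI) = det(P − zI)^m` for all `z`;
in other words the eigenvalues of `𝓜^m` are the eigenvalues of `P`, each with
multiplicity `m`. -/
theorem statement4 (m n : ℕ) (hm : 1 ≤ m) (M : Fin m → Matrix (Fin n) (Fin n) ℂ) (z : ℂ) :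
    ((cyclicBlock M) ^ m - z • 1).det = (((List.ofFn M).prod - z • 1).det) ^ m ∧
    ((cyclicBlock M) ^ m).charpoly.roots = m • ((List.ofFn M).prod).charpoly.roots := by
  constructor
  · simp [det_sub_smul_one, charpoly_cyclicBlock_pow_self hm, mul_pow, ← pow_mul, mul_comm m]
  · rw [charpoly_cyclicBlock_pow_self hm, Polynomial.roots_pow]

end
end

section
/- Let ξ be a real-valued random variable with mean zero, variance one, and E|ξ|^{4+τ} < ∞ for some τ > 0, and let ε > 0 satisfy n^{4ε}·E[|ξ|⁴·1_{|ξ| > n^{1/2−ε}}] → 0 as n → ∞. For each n define ξ̃ := ξ·1_{|ξ| ≤ n^{1/2−ε}} − E[ξ·1_{|ξ| ≤ n^{1/2−ε}}] and ξ̂ := ξ̃ / √(Var ξ̃). Then: (i) n^{1+2ε}·|1 − Var(ξ̃)| → 0 as n → ∞; (ii) there exists N₀ > 0 such that for every n > N₀, Var(ξ̃) > 0, ξ̂ has mean zero and variance one, and |ξ̂| ≤ 4·n^{1/2−ε} almost surely; (iii) there exists N₀ > 0 such that for every n > N₀, E|ξ̂|⁴ ≤ 2⁸·E|ξ|⁴.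 -/
open MeasureTheory ProbabilityTheory Filter Topology

noncomputable section

/-- the truncated-and-recentered random variable `Ỹ = Y·1_{|Y|≤L} − E[Y·1_{|Y|≤L}]` -/
def truncRV {Ω : Type*} [MeasurableSpace Ω] (P : Measure Ω) (L : ℝ) (Y : Ω → ℝ) : Ω → ℝ :=
  fun ω => (if |Y ω| ≤ L then Y ω else 0) - ∫ ω', (if |Y ω'| ≤ L then Y ω' else 0) ∂P

/-- the standardized truncation `Ŷ = Ỹ / √(Var Ỹ)` -/
def hatRV {Ω : Type*} [MeasurableSpace Ω] (P : Measure Ω) (L : ℝ) (Y : Ω → ℝ) : Ω → ℝ :=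
  fun ω => truncRV P L Y ω / Real.sqrt (variance (truncRV P L Y) P)

lemma measurable_ite_abs_le {Ω : Type*} [MeasurableSpace Ω] {Y : Ω → ℝ} (hY : Measurable Y)
    (L : ℝ) : Measurable (fun ω => if |Y ω| ≤ L then Y ω else 0) := by
  refine Measurable.ite (measurableSet_le ?_ measurable_const) hY measurable_const
  exact continuous_abs.measurable.comp hY

lemma abs_ite_abs_le_le {L : ℝ} (hL : 0 ≤ L) (y : ℝ) : |if |y| ≤ L then y else 0| ≤ L := by
  split_ifs with h
  · exact h
  · simpa using hL

lemma memLp_ite_abs_le {Ω : Type*} [MeasurableSpace Ω] {P : Measure Ω} [IsFiniteMeasure P]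
    {Y : Ω → ℝ} (hY : Measurable Y) {L : ℝ} (hL : 0 ≤ L) (p : ENNReal) :
    MemLp (fun ω => if |Y ω| ≤ L then Y ω else 0) p P :=
  MemLp.of_bound (measurable_ite_abs_le hY L).aestronglyMeasurable L
    (ae_of_all _ fun ω => abs_ite_abs_le_le hL (Y ω))

lemma memLp_truncRV {Ω : Type*} [MeasurableSpace Ω] {P : Measure Ω} [IsFiniteMeasure P]
    {Y : Ω → ℝ} (hY : Measurable Y) {L : ℝ} (hL : 0 ≤ L) (p : ENNReal) :
    MemLp (truncRV P L Y) p P :=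
  (memLp_ite_abs_le hY hL p).sub (memLp_const _)

lemma sq_integral_le_integral_sq {Ω : Type*} [MeasurableSpace Ω] {P : Measure Ω}
    [IsProbabilityMeasure P] {X : Ω → ℝ} (hX : MemLp X 2 P) :
    (∫ ω, X ω ∂P) ^ 2 ≤ ∫ ω, X ω ^ 2 ∂P := by
  have h := variance_nonneg X P
  rw [variance_eq_sub hX] at h
  simpa using h

lemma integrable_pow_four {Ω : Type*} [MeasurableSpace Ω] {P : Measure Ω} [IsFiniteMeasure P]
    {X : Ω → ℝ} (hX : MemLp X 4 P) : Integrable (fun ω => X ω ^ 4) P := by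
  refine (hX.integrable_norm_pow (p := 4) (by norm_num)).congr (ae_of_all _ fun ω => ?_)
  simp only [Real.norm_eq_abs]
  exact Even.pow_abs (by decide) _

lemma integral_truncRV {Ω : Type*} [MeasurableSpace Ω] {P : Measure Ω} [IsProbabilityMeasure P]
    {Y : Ω → ℝ} (hY : Measurable Y) {L : ℝ} (hL : 0 ≤ L) :
    ∫ ω, truncRV P L Y ω ∂P = 0 := by
  unfold truncRV
  rw [integral_sub (memLp_one_iff_integrable.1 (memLp_ite_abs_le hY hL 1)) (integrable_const _)]
  simp

/-- The variance lost by truncation is at most twice the second moment of the discarded tail,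
which is controlled by the fourth moment of the tail. -/
lemma sq_mul_abs_one_sub_variance_truncRV_le {Ω : Type*} [MeasurableSpace Ω] {P : Measure Ω}
    [IsProbabilityMeasure P] {Y : Ω → ℝ} (hY : Measurable Y) (hY4 : MemLp Y 4 P)
    (hmean : ∫ ω, Y ω ∂P = 0) (hvar : variance Y P = 1) {L : ℝ} (hL : 0 ≤ L) :
    L ^ 2 * |1 - variance (truncRV P L Y) P| ≤
      2 * ∫ ω, (if L < |Y ω| then |Y ω| ^ 4 else 0) ∂P := by
  set T : Ω → ℝ := fun ω => if |Y ω| ≤ L then Y ω else 0 with hT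
  set D : Ω → ℝ := fun ω => Y ω - T ω with hD
  have hY2 : MemLp Y 2 P := hY4.mono_exponent (by norm_num)
  have hT2 : MemLp T 2 P := memLp_ite_abs_le hY hL 2
  have hD2 : MemLp D 2 P := hY2.sub hT2
  have hD4 : MemLp D 4 P := hY4.sub (memLp_ite_abs_le hY hL 4)
  have hD4i : Integrable (fun ω => D ω ^ 4) P := integrable_pow_four hD4
  have hmeanT : ∫ ω, T ω ∂P = -∫ ω, D ω ∂P := by
    rw [hD, integral_sub (hY2.integrable (by norm_num)) (hT2.integrable (by norm_num)), hmean]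
    ring
  have hYsq : ∫ ω, Y ω ^ 2 ∂P = 1 := by
    rw [variance_eq_sub hY2, hmean] at hvar
    simpa using hvar
  have hsqT : ∫ ω, T ω ^ 2 ∂P = 1 - ∫ ω, D ω ^ 2 ∂P := by
    rw [← hYsq, ← integral_sub hY2.integrable_sq hD2.integrable_sq]
    refine integral_congr_ae (ae_of_all _ fun ω => ?_)
    simp only [hD, hT]
    split_ifs <;> ring
  have hvarT : variance (truncRV P L Y) P = variance T P :=
    variance_sub_const hT2.aestronglyMeasurable _
  have hgap : 1 - variance (truncRV P L Y) P = ∫ ω, D ω ^ 2 ∂P + (∫ ω, D ω ∂P) ^ 2 := by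
    rw [hvarT, variance_eq_sub hT2]
    simp only [Pi.pow_apply]
    rw [hsqT, hmeanT]
    ring
  have hDsq := sq_integral_le_integral_sq hD2
  have hD0 : 0 ≤ ∫ ω, D ω ^ 2 ∂P := integral_nonneg fun ω => sq_nonneg _
  have htail : L ^ 2 * ∫ ω, D ω ^ 2 ∂P ≤ ∫ ω, D ω ^ 4 ∂P := by
    rw [← integral_const_mul]
    refine integral_mono (hD2.integrable_sq.const_mul _) hD4i fun ω => ?_
    simp only [hD, hT]
    split_ifs with h
    · simp
    · have h2 : L ^ 2 ≤ Y ω ^ 2 := by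
        rw [← sq_abs (Y ω)]
        exact pow_le_pow_left₀ hL (not_le.1 h).le 2
      nlinarith [sq_nonneg (Y ω)]
  have hDint : ∫ ω, D ω ^ 4 ∂P = ∫ ω, (if L < |Y ω| then |Y ω| ^ 4 else 0) ∂P := by
    refine integral_congr_ae (ae_of_all _ fun ω => ?_)
    simp only [hD, hT]
    rcases le_or_gt |Y ω| L with h | h
    · simp [h, not_lt.2 h]
    · simp [h, not_le.2 h, Even.pow_abs (show Even 4 by decide)]
  rw [← hDint, hgap, abs_of_nonneg (by positivity)]
  nlinarith [mul_le_mul_of_nonneg_left hDsq (sq_nonneg L)]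

lemma integral_truncRV_pow_four_le {Ω : Type*} [MeasurableSpace Ω] {P : Measure Ω}
    [IsProbabilityMeasure P] {Y : Ω → ℝ} (hY : Measurable Y) (hY4 : MemLp Y 4 P)
    {L : ℝ} (hL : 0 ≤ L) :
    ∫ ω, truncRV P L Y ω ^ 4 ∂P ≤ 16 * ∫ ω, |Y ω| ^ 4 ∂P := by
  set T : Ω → ℝ := fun ω => if |Y ω| ≤ L then Y ω else 0 with hT
  have hT4 : Integrable (fun ω => T ω ^ 4) P := integrable_pow_four (memLp_ite_abs_le hY hL 4)
  have hTsq : MemLp (fun ω => T ω ^ 2) 2 P := by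
    rw [memLp_two_iff_integrable_sq ((measurable_ite_abs_le hY L).pow_const 2).aestronglyMeasurable]
    refine hT4.congr (ae_of_all _ fun ω => ?_)
    ring
  have hjensen : (∫ ω, T ω ∂P) ^ 4 ≤ ∫ ω, T ω ^ 4 ∂P := by
    have h1 := sq_integral_le_integral_sq (memLp_ite_abs_le (P := P) hY hL 2)
    have h2 := sq_integral_le_integral_sq hTsq
    calc (∫ ω, T ω ∂P) ^ 4 = ((∫ ω, T ω ∂P) ^ 2) ^ 2 := by ring
      _ ≤ (∫ ω, T ω ^ 2 ∂P) ^ 2 := pow_le_pow_left₀ (sq_nonneg _) h1 2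
      _ ≤ ∫ ω, (T ω ^ 2) ^ 2 ∂P := h2
      _ = ∫ ω, T ω ^ 4 ∂P := by simp only [← pow_mul]
  have hTY : ∫ ω, T ω ^ 4 ∂P ≤ ∫ ω, |Y ω| ^ 4 ∂P := by
    refine integral_mono hT4 ((integrable_pow_four hY4).congr (ae_of_all _ fun ω => ?_)) fun ω => ?_
    · exact (Even.pow_abs (by decide) _).symm
    · simp only [hT, Even.pow_abs (show Even 4 by decide)]
      split_ifs
      · exact le_rfl
      · rw [zero_pow (by norm_num)]
        exact Even.pow_nonneg (by decide) _
  have hmain : ∫ ω, truncRV P L Y ω ^ 4 ∂P ≤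
      ∫ ω, (8 * T ω ^ 4 + 8 * (∫ ω', T ω' ∂P) ^ 4) ∂P := by
    refine integral_mono (integrable_pow_four (memLp_truncRV hY hL 4))
      ((hT4.const_mul 8).add (integrable_const _)) fun ω => ?_
    have key : ∀ a b : ℝ, (a - b) ^ 4 ≤ 8 * a ^ 4 + 8 * b ^ 4 := fun a b => by
      have h1 : (a - b) ^ 2 ≤ 2 * (a ^ 2 + b ^ 2) := by nlinarith [sq_nonneg (a + b)]
      have h2 := pow_le_pow_left₀ (sq_nonneg _) h1 2
      nlinarith [sq_nonneg (a ^ 2 - b ^ 2)]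
    exact key _ _
  rw [integral_add (hT4.const_mul 8) (integrable_const _), integral_const_mul] at hmain
  simp only [integral_const, probReal_univ, one_smul] at hmain
  linarith

/-- properties of the truncation at level `n^{1/2−ε}` of a mean-zero,
variance-one real random variable `ξ` with finite `(4+τ)`-th moment, assuming
`n^{4ε}·E[|ξ|⁴·1_{|ξ| > n^{1/2−ε}}] → 0`:
(i) `n^{1+2ε}·|1 − Var(ξ̃ₙ)| → 0`;
(ii) for all large `n`, `ξ̂ₙ` has mean zero and variance one and `|ξ̂ₙ| ≤ 4n^{1/2−ε}` a.s.;
(iii) for all large `n`, `E|ξ̂ₙ|⁴ ≤ 2⁸·E|ξ|⁴`. -/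
theorem statement6
    (Ω : Type*) [MeasurableSpace Ω] (P : Measure Ω) [IsProbabilityMeasure P]
    (ξ : Ω → ℝ) (hξmeas : Measurable ξ)
    (τ : ℝ) (hτ : 0 < τ)
    (hmean : ∫ ω, ξ ω ∂P = 0) (hvar : variance ξ P = 1)
    (hmom : Integrable (fun ω => |ξ ω| ^ ((4 : ℝ) + τ)) P)
    (ε : ℝ) (hε : 0 < ε)
    (hεcond : Tendsto (fun n : ℕ => (n : ℝ) ^ (4 * ε) *
        ∫ ω, (if (n : ℝ) ^ ((1:ℝ)/2 - ε) < |ξ ω| then |ξ ω| ^ 4 else 0) ∂P) atTop (𝓝 0)) :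
    (Tendsto (fun n : ℕ =>
        (n : ℝ) ^ (1 + 2 * ε) * |1 - variance (truncRV P ((n : ℝ) ^ ((1:ℝ)/2 - ε)) ξ) P|)
      atTop (𝓝 0)) ∧
    (∃ N₀ : ℕ, 0 < N₀ ∧ ∀ n : ℕ, N₀ < n →
        0 < variance (truncRV P ((n : ℝ) ^ ((1:ℝ)/2 - ε)) ξ) P ∧
        (∫ ω, hatRV P ((n : ℝ) ^ ((1:ℝ)/2 - ε)) ξ ω ∂P) = 0 ∧
        variance (hatRV P ((n : ℝ) ^ ((1:ℝ)/2 - ε)) ξ) P = 1 ∧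
        (∀ᵐ ω ∂P, |hatRV P ((n : ℝ) ^ ((1:ℝ)/2 - ε)) ξ ω| ≤ 4 * (n : ℝ) ^ ((1:ℝ)/2 - ε))) ∧
    (∃ N₀ : ℕ, 0 < N₀ ∧ ∀ n : ℕ, N₀ < n →
        (∫ ω, |hatRV P ((n : ℝ) ^ ((1:ℝ)/2 - ε)) ξ ω| ^ 4 ∂P) ≤ 2 ^ 8 * ∫ ω, |ξ ω| ^ 4 ∂P) := by
  have hξ4 : MemLp ξ 4 P := by
    rw [← integrable_norm_rpow_iff hξmeas.aestronglyMeasurable (by norm_num) (by norm_num)]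
    refine (hmom.add (integrable_const 1)).mono'
      (hξmeas.norm.pow_const _).aestronglyMeasurable (ae_of_all _ fun ω => ?_)
    simp only [Real.norm_eq_abs, Pi.add_apply, ENNReal.toReal_ofNat]
    rw [abs_of_nonneg (by positivity)]
    rcases le_total |ξ ω| 1 with h | h
    · have := Real.rpow_le_one (abs_nonneg (ξ ω)) h (show (0 : ℝ) ≤ 4 by norm_num)
      have : 0 ≤ |ξ ω| ^ ((4 : ℝ) + τ) := by positivity
      linarith
    · have := Real.rpow_le_rpow_of_exponent_le h (show (4 : ℝ) ≤ 4 + τ by linarith)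
      linarith
  have hL : ∀ n : ℕ, 0 ≤ (n : ℝ) ^ ((1:ℝ)/2 - ε) := fun n => by positivity
  have hlim : Tendsto (fun n : ℕ =>
      (n : ℝ) ^ (1 + 2 * ε) * |1 - variance (truncRV P ((n : ℝ) ^ ((1:ℝ)/2 - ε)) ξ) P|)
      atTop (𝓝 0) := by
    refine squeeze_zero' (Eventually.of_forall fun n => by positivity) ?_
      (by simpa using hεcond.const_mul 2)
    filter_upwards [eventually_gt_atTop 0] with n hn
    have hn' : (0 : ℝ) < n := by exact_mod_cast hn
    have hexp : (n : ℝ) ^ (1 + 2 * ε) = (n : ℝ) ^ (4 * ε) * ((n : ℝ) ^ ((1:ℝ)/2 - ε)) ^ 2 := by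
      rw [← Real.rpow_natCast, ← Real.rpow_mul hn'.le, ← Real.rpow_add hn']
      congr 1
      push_cast
      ring
    have hgap := mul_le_mul_of_nonneg_left
      (sq_mul_abs_one_sub_variance_truncRV_le hξmeas hξ4 hmean hvar (hL n))
      (show 0 ≤ (n : ℝ) ^ (4 * ε) by positivity)
    rw [hexp]
    linarith
  obtain ⟨N, hN⟩ := eventually_atTop.1 (hlim.eventually_lt_const (show (0 : ℝ) < 3 / 4 by norm_num))
  have hvarlb : ∀ n : ℕ, N + 1 < n →
      1 / 4 ≤ variance (truncRV P ((n : ℝ) ^ ((1:ℝ)/2 - ε)) ξ) P := fun n hn => by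
    have h1 : (1 : ℝ) ≤ (n : ℝ) ^ (1 + 2 * ε) :=
      Real.one_le_rpow (by exact_mod_cast (show 1 ≤ n by omega)) (by positivity)
    have h2 := hN n (by omega)
    have h3 := le_mul_of_one_le_left
      (abs_nonneg (1 - variance (truncRV P ((n : ℝ) ^ ((1:ℝ)/2 - ε)) ξ) P)) h1
    linarith [le_abs_self (1 - variance (truncRV P ((n : ℝ) ^ ((1:ℝ)/2 - ε)) ξ) P)]
  refine ⟨hlim, ⟨N + 1, by omega, fun n hn => ?_⟩, ⟨N + 1, by omega, fun n hn => ?_⟩⟩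
  · have hv := hvarlb n hn
    have hLn := hL n
    set L := (n : ℝ) ^ ((1:ℝ)/2 - ε)
    set v := variance (truncRV P L ξ) P with hv_def
    have hv0 : 0 < v := by linarith
    have hhat : hatRV P L ξ = fun ω => (√v)⁻¹ * truncRV P L ξ ω := by
      funext ω
      rw [hatRV, div_eq_inv_mul]
    refine ⟨hv0, ?_, ?_, ae_of_all _ fun ω => ?_⟩
    · rw [hhat, integral_const_mul, integral_truncRV hξmeas hLn, mul_zero]
    · rw [hhat, variance_const_mul, ← hv_def, inv_pow, Real.sq_sqrt hv0.le,
        inv_mul_cancel₀ hv0.ne']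
    · have hs : 1 / 2 ≤ √v := Real.le_sqrt_of_sq_le (by norm_num; linarith)
      have hmean_le : |∫ ω', (if |ξ ω'| ≤ L then ξ ω' else 0) ∂P| ≤ L := by
        have h := norm_integral_le_of_norm_le_const (μ := P)
          (f := fun ω' => if |ξ ω'| ≤ L then ξ ω' else 0)
          (ae_of_all _ fun ω' => abs_ite_abs_le_le hLn (ξ ω'))
        simpa using h
      have htr : |truncRV P L ξ ω| ≤ 2 * L := by
        have h := abs_sub (if |ξ ω| ≤ L then ξ ω else 0)
          (∫ ω', (if |ξ ω'| ≤ L then ξ ω' else 0) ∂P)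
        have h' := abs_ite_abs_le_le hLn (ξ ω)
        unfold truncRV
        linarith
      rw [hatRV, abs_div, abs_of_nonneg (Real.sqrt_nonneg _), div_le_iff₀ (by linarith)]
      nlinarith
  · have hv := hvarlb n hn
    have hLn := hL n
    set L := (n : ℝ) ^ ((1:ℝ)/2 - ε)
    set v := variance (truncRV P L ξ) P with hv_def
    have hv0 : 0 < v := by linarith
    have hhat : ∀ ω, |hatRV P L ξ ω| ^ 4 = (v ^ 2)⁻¹ * truncRV P L ξ ω ^ 4 := fun ω => by
      rw [Even.pow_abs (by decide), hatRV, div_pow, ← hv_def, div_eq_inv_mul,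
        show √v ^ 4 = (√v ^ 2) ^ 2 by ring, Real.sq_sqrt hv0.le]
    simp only [hhat]
    rw [integral_const_mul, inv_mul_le_iff₀ (by positivity)]
    have h4 := integral_truncRV_pow_four_le hξmeas hξ4 hLn
    have hm : 0 ≤ ∫ ω, |ξ ω| ^ 4 ∂P := integral_nonneg fun ω => by positivity
    have hv2 : 1 / 16 ≤ v ^ 2 := by nlinarith
    nlinarith [mul_le_mul_of_nonneg_right hv2 hm]

end
end
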